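/- arXiv:2603.26066 — 2 statements merged into one kernel-verified Lean document; each statement's English description precedes it below -/
import Mathlib

section
/- Consider Algorithm 1 (SCRiBLe on the shrunk set K_δ) with learning rate η satisfying η ≤ 1/(4d), run on loss functions satisfying |f_t(x)| ≤ 1 for all x ∈ K. Then for every round t, the estimator g_t := d·f_t(y_t)·A_t^{-1}μ_t satisfies ‖g_t‖*_{x_t} := √(g_tᵀ(∇²R(x_t))^{-1}g_t) ≤ d, and the next iterate satisfies x_{t+1} ∈ W_{4dη}(x_t), where W_r(x) := { y ∈ K_δ : ‖y − x‖_x < r } and ‖h‖_x := √(hᵀ∇²R(x)h); in particular ‖x_{t+1} − x_t‖_{x_t} < 4dη. -/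
open MeasureTheory Matrix Finset Filter

/-- The Hessian matrix `∇²R(x)` of `R : ℝ^d → ℝ` at `x`, with entries given by the
second iterated Fréchet derivative evaluated at pairs of standard basis vectors. -/
noncomputable def hessMat (d : ℕ) (R : (Fin d → ℝ) → ℝ) (x : Fin d → ℝ) :
    Matrix (Fin d) (Fin d) ℝ :=
  Matrix.of fun i j => iteratedFDeriv ℝ 2 R x ![Pi.single i 1, Pi.single j 1]

/-- The local norm `‖h‖_x := √(hᵀ ∇²R(x) h)`. -/
noncomputable def locNorm (d : ℕ) (R : (Fin d → ℝ) → ℝ) (x h : Fin d → ℝ) : ℝ :=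
  Real.sqrt (h ⬝ᵥ (hessMat d R x).mulVec h)

/-- The dual local norm `‖h‖*_x := √(hᵀ (∇²R(x))⁻¹ h)`. -/
noncomputable def dualNorm (d : ℕ) (R : (Fin d → ℝ) → ℝ) (x h : Fin d → ℝ) : ℝ :=
  Real.sqrt (h ⬝ᵥ ((hessMat d R x)⁻¹).mulVec h)

/-- `R` is a `ν`-self-concordant barrier on the convex set `K ⊆ ℝ^d`:
`R` is `C³` and convex on `int K`, blows up at the boundary of `K`, and satisfies
`|D³R(x)[h,h,h]| ≤ 2‖h‖_x³` and `|⟨∇R(x),h⟩| ≤ √ν ‖h‖_x` on `int K`. -/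
def IsSCBarrier (d : ℕ) (K : Set (Fin d → ℝ)) (ν : ℝ) (R : (Fin d → ℝ) → ℝ) : Prop :=
  ContDiffOn ℝ 3 R (interior K) ∧
    ConvexOn ℝ (interior K) R ∧
    (∀ b ∈ frontier K, Filter.Tendsto R (nhdsWithin b (interior K)) Filter.atTop) ∧
    (∀ x ∈ interior K, ∀ h : Fin d → ℝ,
      |iteratedFDeriv ℝ 3 R x ![h, h, h]| ≤ 2 * locNorm d R x h ^ 3) ∧
    (∀ x ∈ interior K, ∀ h : Fin d → ℝ,
      |fderiv ℝ R x h| ≤ Real.sqrt ν * locNorm d R x h)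

/-- The shrunk set `K_δ := { x | x/(1−δ) ∈ K }`. -/
def shrink (d : ℕ) (δ : ℝ) (K : Set (Fin d → ℝ)) : Set (Fin d → ℝ) :=
  {x | (1 - δ)⁻¹ • x ∈ K}

theorem sqrt_le_sqrt_mul_of_abs_deriv_le {ψ ψ' : ℝ → ℝ} {s : Set ℝ} (hs : Convex ℝ s)
    (hψ : ∀ u ∈ s, HasDerivAt ψ (ψ' u) u) (h0 : ∀ u ∈ s, 0 ≤ ψ u)
    (hb : ∀ u ∈ s, |ψ' u| ≤ 2 * √(ψ u) ^ 3) {a b : ℝ} (ha : a ∈ s) (hbs : b ∈ s) :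
    √(ψ a) ≤ √(ψ b) * (1 + |b - a| * √(ψ a)) := by
  have key : ∀ ε : ℝ, 0 < ε → √(ψ a + ε) ≤ √(ψ b + ε) * (1 + |b - a| * √(ψ a + ε)) := by
    intro ε hε
    have hpos : ∀ u ∈ s, 0 < √(ψ u + ε) := fun u hu =>
      Real.sqrt_pos.2 (by linarith [h0 u hu])
    have hder : ∀ u ∈ s, HasDerivWithinAt (fun u => (√(ψ u + ε))⁻¹)
        (-(ψ' u / (2 * √(ψ u + ε))) / √(ψ u + ε) ^ 2) s u := fun u hu =>
      ((((hψ u hu).add_const ε).sqrt (by linarith [h0 u hu])).fun_inv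
        (hpos u hu).ne').hasDerivWithinAt
    have hbound : ∀ u ∈ s, ‖-(ψ' u / (2 * √(ψ u + ε))) / √(ψ u + ε) ^ 2‖ ≤ 1 := by
      intro u hu
      have hp := hpos u hu
      rw [norm_div, norm_neg, norm_div, Real.norm_of_nonneg (by positivity : 0 ≤ 2 * √(ψ u + ε)),
        Real.norm_of_nonneg (by positivity : 0 ≤ √(ψ u + ε) ^ 2), Real.norm_eq_abs, div_div,
        div_le_one (by positivity)]
      have : √(ψ u) ^ 3 ≤ √(ψ u + ε) ^ 3 := by
        gcongr
        linarith
      nlinarith [hb u hu]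
    have h1 := hs.norm_image_sub_le_of_norm_hasDerivWithin_le hder hbound ha hbs
    rw [one_mul, Real.norm_eq_abs, Real.norm_eq_abs] at h1
    have h2 : (√(ψ b + ε))⁻¹ ≤ (√(ψ a + ε))⁻¹ + |b - a| := by
      linarith [le_abs_self ((√(ψ b + ε))⁻¹ - (√(ψ a + ε))⁻¹)]
    have hpa := hpos a ha
    have hpb := hpos b hbs
    calc √(ψ a + ε) = √(ψ a + ε) * √(ψ b + ε) * (√(ψ b + ε))⁻¹ := by field_simp
      _ ≤ √(ψ a + ε) * √(ψ b + ε) * ((√(ψ a + ε))⁻¹ + |b - a|) := by gcongr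
      _ = √(ψ b + ε) * (1 + |b - a| * √(ψ a + ε)) := by field_simp
  have hL : Tendsto (fun ε : ℝ => √(ψ a + ε)) (nhdsWithin 0 (Set.Ioi 0)) (nhds √(ψ a)) := by
    have : Continuous (fun ε : ℝ => √(ψ a + ε)) := by fun_prop
    simpa using (this.tendsto 0).mono_left nhdsWithin_le_nhds
  have hM : Tendsto (fun ε : ℝ => √(ψ b + ε) * (1 + |b - a| * √(ψ a + ε)))
      (nhdsWithin 0 (Set.Ioi 0)) (nhds (√(ψ b) * (1 + |b - a| * √(ψ a)))) := by
    have : Continuous (fun ε : ℝ => √(ψ b + ε) * (1 + |b - a| * √(ψ a + ε))) := by fun_prop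
    simpa using (this.tendsto 0).mono_left nhdsWithin_le_nhds
  exact le_of_tendsto_of_tendsto hL hM (eventually_mem_nhdsWithin.mono key)

theorem hasDerivAt_iteratedFDeriv_line {E F : Type*} [NormedAddCommGroup E] [NormedSpace ℝ E]
    [NormedAddCommGroup F] [NormedSpace ℝ F] (n : ℕ) {f : E → F} {x h : E} {s : ℝ}
    (hf : ContDiffAt ℝ (n + 1) f (x + s • h)) :
    HasDerivAt (fun u : ℝ => iteratedFDeriv ℝ n f (x + u • h) fun _ => h)
      (iteratedFDeriv ℝ (n + 1) f (x + s • h) fun _ => h) s := by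
  have h1 : DifferentiableAt ℝ (iteratedFDeriv ℝ n f) (x + s • h) :=
    hf.differentiableAt_iteratedFDeriv (by exact_mod_cast n.lt_succ_self)
  have h2 : HasDerivAt (fun u : ℝ => x + u • h) h s := by
    simpa using ((hasDerivAt_id s).smul_const h).const_add x
  have h3 := h1.hasFDerivAt.comp_hasDerivAt s h2
  exact ((ContinuousMultilinearMap.apply ℝ (fun _ : Fin n => E) F
    (fun _ => h)).hasFDerivAt.comp_hasDerivAt s h3)

theorem iteratedFDeriv_two_line_nonneg {E : Type*} [NormedAddCommGroup E] [NormedSpace ℝ E]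
    {U : Set E} (hU : IsOpen U) {R : E → ℝ} (hR : ContDiffOn ℝ 2 R U)
    (hc : ConvexOn ℝ U R) {p : E} (hp : p ∈ U) (h : E) :
    0 ≤ iteratedFDeriv ℝ 2 R p fun _ => h := by
  set S : Set ℝ := (fun u : ℝ => p + u • h) ⁻¹' U with hSdef
  have hSo : IsOpen S := hU.preimage (by fun_prop)
  have h0S : (0 : ℝ) ∈ S := by simpa [hSdef] using hp
  have hcd : ∀ u ∈ S, ContDiffAt ℝ 2 R (p + u • h) := fun u hu =>
    hR.contDiffAt (hU.mem_nhds hu)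
  have hd1 : ∀ u ∈ S, HasDerivAt (fun u : ℝ => R (p + u • h))
      (iteratedFDeriv ℝ 1 R (p + u • h) fun _ => h) u := fun u hu => by
    simpa using hasDerivAt_iteratedFDeriv_line 0
      ((hcd u hu).of_le (by norm_num : ((0 : ℕ) : WithTop ℕ∞) + 1 ≤ 2))
  have hconv : ConvexOn ℝ S (fun u : ℝ => R (p + u • h)) := by
    have := hc.comp_affineMap (AffineMap.lineMap p (p + h) : ℝ →ᵃ[ℝ] E)
    convert! this using 1
    · ext u; simp [hSdef, AffineMap.lineMap_apply, add_comm]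
    · ext u; simp [AffineMap.lineMap_apply, add_comm]
  have hmono := hconv.monotoneOn_deriv fun u hu => (hd1 u hu).differentiableAt
  have hmono' : MonotoneOn (fun u : ℝ => iteratedFDeriv ℝ 1 R (p + u • h) fun _ => h) S :=
    hmono.congr fun u hu => (hd1 u hu).deriv
  have h2 := hasDerivAt_iteratedFDeriv_line 1
      ((hcd 0 h0S).of_le (by norm_num : ((1 : ℕ) : WithTop ℕ∞) + 1 ≤ 2))
  have h3 := hmono'.derivWithin_nonneg (x := 0)
  rw [derivWithin_of_isOpen hSo h0S, h2.deriv] at h3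
  simpa using h3

theorem dotProduct_hessMat_mulVec (d : ℕ) (R : (Fin d → ℝ) → ℝ) (x h : Fin d → ℝ) :
    h ⬝ᵥ (hessMat d R x).mulVec h = iteratedFDeriv ℝ 2 R x fun _ => h := by
  have e : (iteratedFDeriv ℝ 2 R x fun _ => h) = fderiv ℝ (fderiv ℝ R) x h h :=
    iteratedFDeriv_two_apply ..
  rw [e]
  conv_rhs => rw [pi_eq_sum_univ' h]
  simp only [hessMat, dotProduct, mulVec, of_apply, iteratedFDeriv_two_apply, map_sum, map_smul,
    _root_.sum_apply, _root_.smul_apply, smul_eq_mul, Finset.mul_sum]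
  rw [Finset.sum_comm]
  refine Finset.sum_congr rfl fun i _ => Finset.sum_congr rfl fun j _ => ?_
  simp
  ring

namespace IsSCBarrier

variable {d : ℕ} {K : Set (Fin d → ℝ)} {ν : ℝ} {R : (Fin d → ℝ) → ℝ}

theorem contDiffAt (hR : IsSCBarrier d K ν R) {p : Fin d → ℝ} (hp : p ∈ interior K) :
    ContDiffAt ℝ 3 R p :=
  hR.1.contDiffAt (isOpen_interior.mem_nhds hp)

theorem iteratedFDeriv_two_nonneg (hR : IsSCBarrier d K ν R) {p : Fin d → ℝ}
    (hp : p ∈ interior K) (h : Fin d → ℝ) : 0 ≤ iteratedFDeriv ℝ 2 R p fun _ => h :=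
  iteratedFDeriv_two_line_nonneg isOpen_interior (hR.1.of_le (by norm_num)) hR.2.1 hp h

theorem locNorm_sq (hR : IsSCBarrier d K ν R) {p : Fin d → ℝ}
    (hp : p ∈ interior K) (h : Fin d → ℝ) :
    locNorm d R p h ^ 2 = iteratedFDeriv ℝ 2 R p fun _ => h := by
  rw [locNorm, dotProduct_hessMat_mulVec, Real.sq_sqrt (hR.iteratedFDeriv_two_nonneg hp h)]

/-- The first derivative of a barrier along a line. -/
theorem hasDerivAt_line (hR : IsSCBarrier d K ν R) {x h : Fin d → ℝ} {s : ℝ}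
    (hs : x + s • h ∈ interior K) :
    HasDerivAt (fun u : ℝ => R (x + u • h)) (fderiv ℝ R (x + s • h) h) s := by
  simpa using hasDerivAt_iteratedFDeriv_line 0
    ((hR.contDiffAt hs).of_le (by norm_num : ((0 : ℕ) : WithTop ℕ∞) + 1 ≤ 3))

/-- The second derivative of a barrier along a line is the squared local norm. -/
theorem hasDerivAt_fderiv_line (hR : IsSCBarrier d K ν R) {x h : Fin d → ℝ} {s : ℝ}
    (hs : x + s • h ∈ interior K) :
    HasDerivAt (fun u : ℝ => fderiv ℝ R (x + u • h) h) (locNorm d R (x + s • h) h ^ 2) s := by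
  rw [hR.locNorm_sq hs]
  simpa using hasDerivAt_iteratedFDeriv_line 1
    ((hR.contDiffAt hs).of_le (by norm_num : ((1 : ℕ) : WithTop ℕ∞) + 1 ≤ 3))

/-- Self-concordance controls the change of the local norm of a direction along a line. -/
theorem locNorm_le_line (hR : IsSCBarrier d K ν R) {S : Set ℝ} (hS : Convex ℝ S)
    {x h : Fin d → ℝ} (hx : ∀ s ∈ S, x + s • h ∈ interior K) {a b : ℝ} (ha : a ∈ S) (hb : b ∈ S) :
    locNorm d R (x + a • h) h ≤
      locNorm d R (x + b • h) h * (1 + |b - a| * locNorm d R (x + a • h) h) := by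
  simp only [locNorm, dotProduct_hessMat_mulVec]
  refine sqrt_le_sqrt_mul_of_abs_deriv_le
    (ψ := fun u : ℝ => iteratedFDeriv ℝ 2 R (x + u • h) fun _ => h)
    (ψ' := fun u : ℝ => iteratedFDeriv ℝ 3 R (x + u • h) fun _ => h) hS
    (fun u hu => hasDerivAt_iteratedFDeriv_line 2
      ((hR.contDiffAt (hx u hu)).of_le (by norm_num)))
    (fun u hu => hR.iteratedFDeriv_two_nonneg (hx u hu) h) (fun u hu => ?_) ha hb
  have h3 := hR.2.2.2.1 _ (hx u hu) h
  have e : (![h, h, h] : Fin 3 → Fin d → ℝ) = fun _ => h := by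
    ext i; fin_cases i <;> rfl
  rwa [e, locNorm, dotProduct_hessMat_mulVec] at h3

/-- A frontier point of `K` is at local distance at least one from any interior point. -/
theorem one_le_mul_locNorm_of_mem_frontier (hR : IsSCBarrier d K ν R) (hK : Convex ℝ K)
    {x h : Fin d → ℝ} (hx : x ∈ interior K) {s : ℝ} (hs : 0 < s)
    (hfr : x + s • h ∈ frontier K) : 1 ≤ s * locNorm d R x h := by
  by_contra! hlt
  have hin : ∀ u ∈ Set.Ico 0 s, x + u • h ∈ interior K := by
    intro u hu
    have := hK.combo_interior_closure_mem_interior hx (frontier_subset_closure hfr)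
      (a := 1 - u / s) (b := u / s) (by rw [sub_pos, div_lt_one hs]; exact hu.2)
      (div_nonneg hu.1 hs.le) (by ring)
    convert this using 1
    rw [smul_add, smul_smul, div_mul_cancel₀ _ hs.ne']
    module
  have h0 : (0 : ℝ) ∈ Set.Ico 0 s := ⟨le_rfl, hs⟩
  have hr0 : 0 ≤ locNorm d R x h := Real.sqrt_nonneg _
  set C : ℝ := √ν * (locNorm d R x h / (1 - s * locNorm d R x h)) with hC
  have hden : 0 < 1 - s * locNorm d R x h := by linarith
  have hbound : ∀ u ∈ Set.Ico 0 s, ‖fderiv ℝ R (x + u • h) h‖ ≤ C := by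
    intro u hu
    refine (hR.2.2.2.2 _ (hin u hu) h).trans ?_
    rw [hC]
    gcongr
    rw [le_div_iff₀ hden]
    have h1 := hR.locNorm_le_line (convex_Ico 0 s) hin hu h0
    have hu0 : 0 ≤ locNorm d R (x + u • h) h := Real.sqrt_nonneg _
    rw [zero_smul, add_zero, zero_sub, abs_neg, abs_of_nonneg hu.1] at h1
    nlinarith [mul_le_mul_of_nonneg_right hu.2.le (mul_nonneg hr0 hu0)]
  have hRb : ∀ u ∈ Set.Ico 0 s, R (x + u • h) ≤ R x + C * s := by
    intro u hu
    have := (convex_Ico 0 s).norm_image_sub_le_of_norm_hasDerivWithin_le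
      (fun v hv => (hR.hasDerivAt_line (hin v hv)).hasDerivWithinAt) hbound h0 hu
    rw [zero_smul, add_zero, sub_zero, Real.norm_eq_abs, Real.norm_eq_abs,
      abs_of_nonneg hu.1] at this
    have hC0 : 0 ≤ C := by positivity
    nlinarith [le_abs_self (R (x + u • h) - R x), mul_le_mul_of_nonneg_left hu.2.le hC0]
  have hcont : Continuous fun u : ℝ => x + u • h := by fun_prop
  have hlim : Tendsto (fun u : ℝ => x + u • h) (nhdsWithin s (Set.Ico 0 s))
      (nhdsWithin (x + s • h) (interior K)) :=
    tendsto_nhdsWithin_of_tendsto_nhds_of_eventually_within _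
      ((hcont.tendsto s).mono_left nhdsWithin_le_nhds) (eventually_mem_nhdsWithin.mono hin)
  have htop := (hR.2.2.1 _ hfr).comp hlim
  have hne : (nhdsWithin s (Set.Ico 0 s)).NeBot := by
    rw [← mem_closure_iff_nhdsWithin_neBot, closure_Ico hs.ne]
    exact ⟨hs.le, le_rfl⟩
  obtain ⟨u, hu, hu'⟩ := ((htop.eventually_gt_atTop (R x + C * s)).and
    eventually_mem_nhdsWithin).exists
  exact (hRb u hu').not_gt hu

/-- The closed Dikin ellipsoid around an interior point of `K` is contained in `K`. -/
theorem add_mem_of_locNorm_le_one (hR : IsSCBarrier d K ν R) (hK : Convex ℝ K)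
    (hKc : IsClosed K) {x h : Fin d → ℝ} (hx : x ∈ interior K) (hh : locNorm d R x h ≤ 1) :
    x + h ∈ K := by
  have hcont : Continuous fun u : ℝ => x + u • h := by fun_prop
  have hopen : ∀ u ∈ Set.Ico (0 : ℝ) 1, x + u • h ∈ K := by
    have hsub : Set.Ico (0 : ℝ) 1 ⊆ (fun u : ℝ => x + u • h) ⁻¹' interior K := by
      refine isPreconnected_Ico.subset_left_of_subset_union (isOpen_interior.preimage hcont)
        (hKc.isOpen_compl.preimage hcont) ?_ ?_ ⟨0, by simp, by simpa using hx⟩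
      · exact Set.disjoint_left.2 fun u hu hu' => hu' (interior_subset hu)
      · intro u hu
        by_contra hcon
        simp only [Set.mem_union, Set.mem_preimage, Set.mem_compl_iff, not_or, not_not] at hcon
        have hfr : x + u • h ∈ frontier K := by
          rw [hKc.frontier_eq]
          exact ⟨hcon.2, hcon.1⟩
        have hu0 : 0 < u := hu.1.lt_of_ne fun h0 => hcon.1 (by simpa [← h0] using hx)
        have := hR.one_le_mul_locNorm_of_mem_frontier hK hx hu0 hfr
        nlinarith [hu.2]
    exact fun u hu => interior_subset (hsub hu)
  have h1 : (1 : ℝ) ∈ closure (Set.Ico (0 : ℝ) 1) := by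
    rw [closure_Ico zero_ne_one]; simp
  have h2 : x + (1 : ℝ) • h ∈ K := closure_minimal hopen (hKc.preimage hcont) h1
  rwa [one_smul] at h2

/-- Strong monotonicity of the gradient of a self-concordant function. -/
theorem locNorm_sq_div_le_fderiv_sub (hR : IsSCBarrier d K ν R) (hK : Convex ℝ K)
    {x z : Fin d → ℝ} (hx : x ∈ interior K) (hz : z ∈ interior K) :
    locNorm d R x (z - x) ^ 2 / (1 + locNorm d R x (z - x)) ≤
      fderiv ℝ R z (z - x) - fderiv ℝ R x (z - x) := by
  set h := z - x with hh
  set r := locNorm d R x h with hr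
  have hr0 : 0 ≤ r := Real.sqrt_nonneg _
  have hin : ∀ u ∈ Set.Icc (0 : ℝ) 1, x + u • h ∈ interior K := fun u hu =>
    hK.interior.add_smul_sub_mem hx hz hu
  have hder : ∀ u ∈ Set.Icc (0 : ℝ) 1, HasDerivAt
      (fun u : ℝ => fderiv ℝ R (x + u • h) h + r * (1 + u * r)⁻¹)
      (locNorm d R (x + u • h) h ^ 2 + r * (-r / (1 + u * r) ^ 2)) u := by
    intro u hu
    have hp : 1 + u * r ≠ 0 := by nlinarith [mul_nonneg hu.1 hr0]
    have h1 : HasDerivAt (fun u : ℝ => 1 + u * r) r u := by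
      simpa using ((hasDerivAt_id u).mul_const r).const_add 1
    exact (hR.hasDerivAt_fderiv_line (hin u hu)).add ((h1.fun_inv hp).const_mul r)
  have hmono : MonotoneOn (fun u : ℝ => fderiv ℝ R (x + u • h) h + r * (1 + u * r)⁻¹)
      (Set.Icc 0 1) := by
    refine monotoneOn_of_deriv_nonneg (convex_Icc 0 1)
      (fun u hu => (hder u hu).continuousAt.continuousWithinAt)
      (fun u hu => (hder u (interior_subset hu)).differentiableAt.differentiableWithinAt)
      fun u hu => ?_
    have hu := interior_subset hu
    rw [(hder u hu).deriv]
    have hp : 0 < 1 + u * r := by nlinarith [mul_nonneg hu.1 hr0]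
    have h1 := hR.locNorm_le_line (convex_Icc 0 1) hin (Set.left_mem_Icc.2 zero_le_one) hu
    rw [zero_smul, add_zero, ← hr, sub_zero, abs_of_nonneg hu.1] at h1
    have h2 : r ^ 2 ≤ locNorm d R (x + u • h) h ^ 2 * (1 + u * r) ^ 2 := by
      rw [← mul_pow]
      gcongr
    have h3 : r ^ 2 / (1 + u * r) ^ 2 ≤ locNorm d R (x + u • h) h ^ 2 :=
      (div_le_iff₀ (by positivity)).2 h2
    have h4 : r * (-r / (1 + u * r) ^ 2) = -(r ^ 2 / (1 + u * r) ^ 2) := by ring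
    linarith
  have h01 := hmono (Set.left_mem_Icc.2 zero_le_one) (Set.right_mem_Icc.2 zero_le_one) zero_le_one
  have hxz : x + h = z := by simp [hh]
  simp only [zero_smul, add_zero, one_smul, zero_mul, one_mul, inv_one, mul_one, hxz] at h01
  have : r ^ 2 / (1 + r) = r - r * (1 + r)⁻¹ := by
    field_simp
    ring
  linarith

end IsSCBarrier

theorem shrink_subset_interior {d : ℕ} {K : Set (Fin d → ℝ)} (hK : Convex ℝ K)
    (h0 : (0 : Fin d → ℝ) ∈ interior K) {δ : ℝ} (hδ0 : 0 < δ) (hδ1 : δ < 1) :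
    shrink d δ K ⊆ interior K := by
  intro z hz
  have hne : 1 - δ ≠ 0 := by linarith
  have := hK.combo_interior_self_mem_interior h0 hz hδ0 (sub_pos.2 hδ1).le (by ring)
  simpa [smul_smul, mul_inv_cancel₀ hne] using this

/-- First-order optimality for the minimum over a convex set of a linear form plus a function. -/
theorem dotProduct_add_fderiv_nonneg_of_isMinOn {d : ℕ} {S : Set (Fin d → ℝ)} (hS : Convex ℝ S)
    {R : (Fin d → ℝ) → ℝ} {a c : Fin d → ℝ} (ha : a ∈ S) (hR : DifferentiableAt ℝ R a)
    (hmin : ∀ z ∈ S, c ⬝ᵥ a + R a ≤ c ⬝ᵥ z + R z) {z : Fin d → ℝ} (hz : z ∈ S) :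
    0 ≤ c ⬝ᵥ (z - a) + fderiv ℝ R a (z - a) := by
  let L : (Fin d → ℝ) →L[ℝ] ℝ := (dotProductBilin ℝ ℝ c).toContinuousLinearMap
  have hm : IsLocalMinOn (fun z => L z + R z) S a :=
    (isMinOn_iff.2 fun z hz => hmin z hz).localize
  exact hm.hasFDerivWithinAt_nonneg (L.hasFDerivAt.add hR.hasFDerivAt).hasFDerivWithinAt
    (sub_mem_posTangentConeAt_of_segment_subset (hS.segment_subset ha hz))

theorem dotProduct_sq_le {n : Type*} [Fintype n] (v w : n → ℝ) :
    (v ⬝ᵥ w) ^ 2 ≤ (v ⬝ᵥ v) * (w ⬝ᵥ w) := by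
  simpa [dotProduct, sq] using Finset.sum_mul_sq_le_sq_mul_sq Finset.univ v w

/-- **Closeness of consecutive SCRiBLe iterates (Lemma 4).**
Run Algorithm 1 (SCRiBLe on the shrunk set `K_δ`) with `η ≤ 1/(4d)` on losses with
`|f_t| ≤ 1` on `K`.  Then for every round `t ∈ [1, T]`, the estimator
`g_t = d f_t(y_t) A_t⁻¹ μ_t` satisfies `‖g_t‖*_{x_t} ≤ d`, and
`x_{t+1} ∈ W_{4dη}(x_t) = {y ∈ K_δ : ‖y − x_t‖_{x_t} < 4dη}`;
in particular `‖x_{t+1} − x_t‖_{x_t} < 4dη`. -/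
theorem scrible_iterates_close (d T : ℕ) (hd : 1 ≤ d)
    (K : Set (Fin d → ℝ)) (hKbdd : Bornology.IsBounded K) (hKcl : IsClosed K)
    (hKconv : Convex ℝ K) (hKsym : ∀ z ∈ K, -z ∈ K)
    (hKball : ∀ z : Fin d → ℝ, (∑ i, z i ^ 2) ≤ 1 → z ∈ K)
    (ν : ℝ) (hν : 1 ≤ ν) (R : (Fin d → ℝ) → ℝ) (hR : IsSCBarrier d K ν R)
    (δ : ℝ) (hδ0 : 0 < δ) (hδ1 : δ < 1)
    (η : ℝ) (hη0 : 0 < η) (hη1 : η ≤ 1 / (4 * d))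
    (f : ℕ → (Fin d → ℝ) → ℝ) (hf1 : ∀ t, ∀ z ∈ K, |f t z| ≤ 1)
    (x y μ g : ℕ → Fin d → ℝ) (A : ℕ → Matrix (Fin d) (Fin d) ℝ)
    (hx1mem : x 1 ∈ shrink d δ K) (hx1min : ∀ z ∈ shrink d δ K, R (x 1) ≤ R z)
    (hA : ∀ t, 1 ≤ t → (A t).PosDef ∧ A t * A t * hessMat d R (x t) = 1)
    (hμ : ∀ t, 1 ≤ t → ∑ i, μ t i ^ 2 = 1)
    (hy : ∀ t, 1 ≤ t → y t = x t + (A t).mulVec (μ t))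
    (hg : ∀ t, 1 ≤ t → g t = ((d : ℝ) * f t (y t)) • ((A t)⁻¹).mulVec (μ t))
    (hxrec : ∀ t, 1 ≤ t → x (t + 1) ∈ shrink d δ K ∧
      ∀ z ∈ shrink d δ K,
        η * (∑ τ ∈ Icc 1 t, g τ ⬝ᵥ x (t + 1)) + R (x (t + 1)) ≤
          η * (∑ τ ∈ Icc 1 t, g τ ⬝ᵥ z) + R z) :
    ∀ t, 1 ≤ t → t ≤ T →
      dualNorm d R (x t) (g t) ≤ d ∧
        x (t + 1) ∈ shrink d δ K ∧
        locNorm d R (x t) (x (t + 1) - x t) < 4 * d * η := by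
  have hdR : (1 : ℝ) ≤ d := by exact_mod_cast hd
  have h0 : (0 : Fin d → ℝ) ∈ interior K := by
    refine mem_interior.2 ⟨{z | ∑ i, z i ^ 2 < 1}, fun z hz => hKball z (le_of_lt hz),
      isOpen_lt (by fun_prop) continuous_const, by simp⟩
  have hSin := shrink_subset_interior hKconv h0 hδ0 hδ1
  have hSconv : Convex ℝ (shrink d δ K) := hKconv.smul_preimage _
  have hxmem : ∀ t, 1 ≤ t → x t ∈ shrink d δ K := by
    intro t ht
    obtain ⟨t, rfl⟩ := Nat.exists_eq_add_of_le' ht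
    rcases Nat.eq_zero_or_pos t with rfl | ht'
    · exact hx1mem
    · exact (hxrec t ht').1
  have hmin : ∀ t, ∀ z ∈ shrink d δ K,
      (η • ∑ τ ∈ Icc 1 t, g τ) ⬝ᵥ x (t + 1) + R (x (t + 1)) ≤
        (η • ∑ τ ∈ Icc 1 t, g τ) ⬝ᵥ z + R z := by
    intro t z hz
    rcases Nat.eq_zero_or_pos t with rfl | ht
    · simpa using hx1min z hz
    · simpa only [smul_dotProduct, sum_dotProduct, smul_eq_mul] using (hxrec t ht).2 z hz
  have hopt : ∀ t, ∀ z ∈ shrink d δ K, 0 ≤ (η • ∑ τ ∈ Icc 1 t, g τ) ⬝ᵥ (z - x (t + 1)) +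
      fderiv ℝ R (x (t + 1)) (z - x (t + 1)) := fun t z hz =>
    dotProduct_add_fderiv_nonneg_of_isMinOn hSconv (hxmem _ (by omega))
      ((hR.contDiffAt (hSin (hxmem _ (by omega)))).differentiableAt (by norm_num)) (hmin t) hz
  intro t ht _
  obtain ⟨hApd, hAH⟩ := hA t ht
  have hxint := hSin (hxmem t ht)
  have hAu : IsUnit (A t).det := (Matrix.isUnit_iff_isUnit_det _).1 hApd.isUnit
  have hAs : (A t)ᵀ = A t := by simpa using hApd.isHermitian.eq
  have hBs : ((A t)⁻¹)ᵀ = (A t)⁻¹ := by rw [transpose_nonsing_inv, hAs]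
  have hHinv : (hessMat d R (x t))⁻¹ = A t * A t := Matrix.inv_eq_left_inv hAH
  have hH : hessMat d R (x t) = (A t)⁻¹ * (A t)⁻¹ := by
    rw [← Matrix.mul_inv_rev]
    exact (Matrix.inv_eq_right_inv hAH).symm
  have hBdot : ∀ v w : Fin d → ℝ, ((A t)⁻¹).mulVec v ⬝ᵥ w = v ⬝ᵥ ((A t)⁻¹).mulVec w := by
    intro v w
    rw [dotProduct_mulVec, ← mulVec_transpose, hBs]
  have hquad : ∀ v : Fin d → ℝ, v ⬝ᵥ (hessMat d R (x t)).mulVec v =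
      ((A t)⁻¹).mulVec v ⬝ᵥ ((A t)⁻¹).mulVec v := by
    intro v
    rw [hH, hBdot, mulVec_mulVec]
  have hμ1 : μ t ⬝ᵥ μ t = 1 := by simpa [dotProduct, sq] using hμ t ht
  have hyK : y t ∈ K := by
    rw [hy t ht]
    refine hR.add_mem_of_locNorm_le_one hKconv hKcl hxint (le_of_eq ?_)
    rw [locNorm, hquad, mulVec_mulVec, nonsing_inv_mul _ hAu, one_mulVec, hμ1, Real.sqrt_one]
  have hf := hf1 t (y t) hyK
  have hcoef : |(d : ℝ) * f t (y t)| ≤ d := by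
    rw [abs_mul, Nat.abs_cast]
    exact mul_le_of_le_one_right (by positivity) hf
  refine ⟨?_, hxmem _ (by omega), ?_⟩
  · have : g t ⬝ᵥ ((hessMat d R (x t))⁻¹).mulVec (g t) = ((d : ℝ) * f t (y t)) ^ 2 := by
      rw [hHinv, hg t ht, mulVec_smul, smul_dotProduct, dotProduct_smul, hBdot, mulVec_mulVec,
        mulVec_mulVec, ← Matrix.mul_assoc, nonsing_inv_mul _ hAu, Matrix.one_mul,
        mul_nonsing_inv _ hAu, one_mulVec, hμ1]
      simp [sq]
    rw [dualNorm, this, Real.sqrt_sq_eq_abs]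
    exact hcoef
  · set h := x (t + 1) - x t with hh
    set r := locNorm d R (x t) h with hr
    have hr0 : 0 ≤ r := Real.sqrt_nonneg _
    have hxint' := hSin (hxmem (t + 1) (by omega))
    have hww : ((A t)⁻¹).mulVec h ⬝ᵥ ((A t)⁻¹).mulVec h = r ^ 2 := by
      rw [hr, hR.locNorm_sq hxint, ← dotProduct_hessMat_mulVec, hquad]
    have hcs : |μ t ⬝ᵥ ((A t)⁻¹).mulVec h| ≤ r := by
      refine abs_le_of_sq_le_sq ?_ hr0
      have := dotProduct_sq_le (μ t) (((A t)⁻¹).mulVec h)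
      rwa [hμ1, one_mul, hww] at this
    have hgh : |g t ⬝ᵥ h| ≤ d * r := by
      rw [hg t ht, smul_dotProduct, hBdot, smul_eq_mul, abs_mul]
      gcongr
    have hgrad := hR.locNorm_sq_div_le_fderiv_sub hKconv hxint hxint'
    rw [← hh, ← hr] at hgrad
    have ho1 := hopt t (x t) (hxmem t ht)
    obtain ⟨s, rfl⟩ := Nat.exists_eq_add_of_le' ht
    have ho2 := hopt s (x (s + 1 + 1)) (hxmem _ (by omega))
    rw [Finset.sum_Icc_succ_top (by omega), smul_add, add_dotProduct,
      ← neg_sub (x (s + 1 + 1)), ← hh] at ho1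
    rw [← hh] at ho2
    simp only [dotProduct_neg, map_neg, smul_dotProduct, smul_eq_mul] at ho1 ho2
    have hup : r ^ 2 / (1 + r) ≤ η * (d * r) := by
      have : η * -(g (s + 1) ⬝ᵥ h) ≤ η * (d * r) := by
        gcongr
        exact (neg_le_abs _).trans hgh
      linarith
    rw [div_le_iff₀ (by positivity)] at hup
    have hηd : d * η ≤ 1 / 4 := by
      rw [le_div_iff₀ (by positivity)] at hη1
      linarith
    have hdη : 0 < d * η := by positivity
    by_contra! hge
    have hrpos : 0 < r := by nlinarith
    have h1 : r ≤ d * η * (1 + r) := by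
      refine le_of_mul_le_mul_left ?_ hrpos
      linarith
    nlinarith [mul_le_mul_of_nonneg_right hηd hr0]
end

section
/- Let (Ω, F, P) be a probability space with a filtration F_0 ⊆ F_1 ⊆ … ⊆ F_T, fix a constant b ≥ e and γ ∈ (0,1), and let X_1, …, X_T be real random variables such that each X_t is F_t-measurable with E[X_t | F_{t−1}] = 0. Suppose B_t is F_{t−1}-measurable with B_t ∈ [1, b] and X_t ≤ B_t almost surely for each t. Set V := max{ 1, Σ_{t=1}^{T} E[X_t² | F_{t−1}] }, B* := max_{t∈[T]} B_t, and S := ⌈ln b⌉·⌈ln(b²T)⌉. Then with probability at least 1 − γ, Σ_{t=1}^{T} X_t ≤ S·( √(8V·ln(S/γ)) + 2B*·ln(S/γ) ). -/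
open MeasureTheory Finset

/-- The constant `S = ⌈ln b⌉ ⌈ln(b²T)⌉`, as a real number. -/
noncomputable def SconstB (b : ℝ) (T : ℕ) : ℝ :=
  ((⌈Real.log b⌉ * ⌈Real.log (b ^ 2 * T)⌉ : ℤ) : ℝ)

lemma Real.exp_le_one_add_add_sq {y : ℝ} (hy : y ≤ 1) : Real.exp y ≤ 1 + y + y ^ 2 := by
  by_cases h : -1 ≤ y
  · have := Real.abs_exp_sub_one_sub_id_le (abs_le.mpr ⟨h, hy⟩)
    linarith [le_abs_self (Real.exp y - 1 - y)]
  · have : Real.exp y ≤ 1 := Real.exp_le_one_iff.mpr (by linarith)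
    nlinarith

/-- The conditional exponential moment of a centered variable bounded above by `1` is controlled
by its conditional variance. -/
lemma condExp_exp_le_exp_condExp_sq {Ω : Type*} {m m0 : MeasurableSpace Ω} {P : Measure Ω}
    [IsProbabilityMeasure P] (hm : m ≤ m0) {Z : Ω → ℝ} (hZ : Integrable Z P)
    (hZsq : Integrable (fun ω => Z ω ^ 2) P) (hZcond : P[Z|m] =ᵐ[P] 0)
    (hZle : ∀ᵐ ω ∂P, Z ω ≤ 1) :
    Integrable (fun ω => Real.exp (Z ω)) P ∧
      P[fun ω => Real.exp (Z ω)|m] ≤ᵐ[P]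
        fun ω => Real.exp ((P[fun ω' => Z ω' ^ 2|m]) ω) := by
  have hint : Integrable (fun ω => Real.exp (Z ω)) P := by
    refine Integrable.of_bound (C := Real.exp 1)
      (Real.continuous_exp.comp_aestronglyMeasurable hZ.1) ?_
    filter_upwards [hZle] with ω h
    rw [Real.norm_eq_abs, Real.abs_exp]
    exact Real.exp_le_exp.mpr h
  refine ⟨hint, ?_⟩
  have h1 : Integrable ((fun _ : Ω => (1 : ℝ)) + Z) P := (integrable_const 1).add hZ
  have hmono := condExp_mono (m := m) hint (h1.add hZsq) (by
    filter_upwards [hZle] with ω h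
    exact Real.exp_le_one_add_add_sq h)
  filter_upwards [hmono, condExp_add h1 hZsq m, condExp_add (integrable_const 1) hZ m, hZcond]
    with ω h2 h3 h4 h5
  rw [h3, Pi.add_apply, h4, Pi.add_apply, h5, condExp_const hm] at h2
  refine h2.trans ?_
  have := Real.add_one_le_exp ((P[fun ω' => Z ω' ^ 2|m]) ω)
  simp only [Pi.zero_apply]
  linarith

/-- The exponential supermartingale of a martingale difference sequence bounded above by `1` has
expectation at most `1`. -/
lemma integral_exp_sum_sub_condExp_sq_le_one {Ω : Type*} {m0 : MeasurableSpace Ω} (P : Measure Ω)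
    [IsProbabilityMeasure P] (ℱ : Filtration ℕ m0) (Z : ℕ → Ω → ℝ) (n : ℕ)
    (hZmeas : ∀ t, 1 ≤ t → t ≤ n → StronglyMeasurable[ℱ t] (Z t))
    (hZ : ∀ t, 1 ≤ t → t ≤ n → Integrable (Z t) P)
    (hZsq : ∀ t, 1 ≤ t → t ≤ n → Integrable (fun ω => Z t ω ^ 2) P)
    (hZcond : ∀ t, 1 ≤ t → t ≤ n → P[Z t|ℱ (t - 1)] =ᵐ[P] 0)
    (hZle : ∀ t, 1 ≤ t → t ≤ n → ∀ᵐ ω ∂P, Z t ω ≤ 1) :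
    StronglyMeasurable[ℱ n] (fun ω => Real.exp (∑ t ∈ Icc 1 n,
      (Z t ω - (P[fun ω' => Z t ω' ^ 2|ℱ (t - 1)]) ω))) ∧
    Integrable (fun ω => Real.exp (∑ t ∈ Icc 1 n,
      (Z t ω - (P[fun ω' => Z t ω' ^ 2|ℱ (t - 1)]) ω))) P ∧
    ∫ ω, Real.exp (∑ t ∈ Icc 1 n,
      (Z t ω - (P[fun ω' => Z t ω' ^ 2|ℱ (t - 1)]) ω)) ∂P ≤ 1 := by
  induction n with
  | zero => simpa using stronglyMeasurable_const
  | succ n ih =>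
    obtain ⟨hM, hMint, hMle⟩ := ih (fun t h1 h2 => hZmeas t h1 (by lia))
      (fun t h1 h2 => hZ t h1 (by lia)) (fun t h1 h2 => hZsq t h1 (by lia))
      (fun t h1 h2 => hZcond t h1 (by lia)) (fun t h1 h2 => hZle t h1 (by lia))
    have hn1 : 1 ≤ n + 1 := by lia
    have hcond := hZcond (n + 1) hn1 le_rfl
    rw [Nat.add_sub_cancel] at hcond
    obtain ⟨hEint, hE⟩ := condExp_exp_le_exp_condExp_sq (ℱ.le n) (hZ _ hn1 le_rfl)
      (hZsq _ hn1 le_rfl) hcond (hZle _ hn1 le_rfl)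
    set M : Ω → ℝ := fun ω => Real.exp (∑ t ∈ Icc 1 n,
      (Z t ω - (P[fun ω' => Z t ω' ^ 2|ℱ (t - 1)]) ω)) with hMdef
    set W : Ω → ℝ := P[fun ω' => Z (n + 1) ω' ^ 2|ℱ n] with hW
    have hWnonneg : 0 ≤ᵐ[P] W := condExp_nonneg (ae_of_all _ fun ω => sq_nonneg _)
    have hWmeas : StronglyMeasurable[ℱ n] W := stronglyMeasurable_condExp
    set N : Ω → ℝ := fun ω => M ω * Real.exp (-W ω) with hN
    have hNmeas : StronglyMeasurable[ℱ n] N :=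
      hM.mul (Real.continuous_exp.comp_stronglyMeasurable hWmeas.neg)
    set E : Ω → ℝ := fun ω => Real.exp (Z (n + 1) ω) with hEdef
    have heq : (fun ω => Real.exp (∑ t ∈ Icc 1 (n + 1),
        (Z t ω - (P[fun ω' => Z t ω' ^ 2|ℱ (t - 1)]) ω))) = N * E := by
      ext ω
      rw [Finset.sum_Icc_succ_top hn1, Nat.add_sub_cancel, Pi.mul_apply, hN, hEdef, hMdef]
      simp only [← Real.exp_add, ← hW]
      congr 1
      ring
    have hEmeas : StronglyMeasurable[ℱ (n + 1)] E :=
      Real.continuous_exp.comp_stronglyMeasurable (hZmeas _ hn1 le_rfl)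
    have hNE : Integrable (N * E) P := by
      refine (hMint.mul_const (Real.exp 1)).mono
        ((hNmeas.mono (ℱ.le n)).mul (hEmeas.mono (ℱ.le _))).aestronglyMeasurable ?_
      filter_upwards [hWnonneg, hZle _ hn1 le_rfl] with ω h1 h2
      have h3 : Real.exp (-W ω) ≤ 1 := Real.exp_le_one_iff.mpr (neg_nonpos.mpr h1)
      have h4 : E ω ≤ Real.exp 1 := Real.exp_le_exp.mpr h2
      have h5 : 0 ≤ M ω := (Real.exp_pos _).le
      have h6 : 0 ≤ Real.exp (-W ω) := (Real.exp_pos _).le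
      have h7 : 0 ≤ E ω := (Real.exp_pos _).le
      simp only [Pi.mul_apply, hN, norm_mul, Real.norm_eq_abs, abs_of_nonneg h5,
        abs_of_nonneg h6, abs_of_nonneg h7, Real.abs_exp]
      calc M ω * Real.exp (-W ω) * E ω ≤ M ω * 1 * Real.exp 1 := by gcongr
        _ = M ω * Real.exp 1 := by ring
    rw [heq]
    refine ⟨(hNmeas.mono (ℱ.mono (by lia))).mul hEmeas, hNE, ?_⟩
    rw [← integral_condExp (ℱ.le n)]
    refine le_trans (integral_mono_ae integrable_condExp hMint ?_) hMle
    filter_upwards [condExp_mul_of_stronglyMeasurable_left hNmeas hNE hEint, hE] with ω h1 h2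
    rw [h1, Pi.mul_apply]
    have h3 : 0 ≤ N ω := mul_nonneg (Real.exp_pos _).le (Real.exp_pos _).le
    calc N ω * (P[E|ℱ n]) ω ≤ N ω * Real.exp (W ω) := by gcongr
      _ = M ω := by
        rw [hN]
        simp only
        rw [mul_assoc, ← Real.exp_add, neg_add_cancel, Real.exp_zero, mul_one]

/-- A one-sided Freedman tail bound at a fixed exponential parameter `l`, on the event that the
predictable bounds and the predictable variation are controlled by deterministic constants. -/
lemma measure_freedman_le {Ω : Type*} {m0 : MeasurableSpace Ω} (P : Measure Ω)
    [IsProbabilityMeasure P] (T : ℕ) (ℱ : Filtration ℕ m0) (X B : ℕ → Ω → ℝ)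
    (hXmeas : ∀ t, 1 ≤ t → t ≤ T → StronglyMeasurable[ℱ t] (X t))
    (hXint : ∀ t, 1 ≤ t → t ≤ T → Integrable (X t) P)
    (hXsq : ∀ t, 1 ≤ t → t ≤ T → Integrable (fun ω => X t ω ^ 2) P)
    (hXcond : ∀ t, 1 ≤ t → t ≤ T → P[X t|ℱ (t - 1)] =ᵐ[P] 0)
    (hBmeas : ∀ t, 1 ≤ t → t ≤ T → StronglyMeasurable[ℱ (t - 1)] (B t))
    (hXB : ∀ t, 1 ≤ t → t ≤ T → ∀ᵐ ω ∂P, X t ω ≤ B t ω)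
    (l c v x : ℝ) (hl : 0 ≤ l) (hlc : l * c ≤ 1) :
    P {ω | (∀ t ∈ Icc 1 T, B t ω ≤ c) ∧
      ∑ t ∈ Icc 1 T, (P[fun ω' => X t ω' ^ 2|ℱ (t - 1)]) ω ≤ v ∧
      l ^ 2 * v + x ≤ l * ∑ t ∈ Icc 1 T, X t ω} ≤ ENNReal.ofReal (Real.exp (-x)) := by
  set A : ℕ → Set Ω := fun t => {ω | B t ω ≤ c} with hA
  have hAmeas : ∀ t, 1 ≤ t → t ≤ T → MeasurableSet[ℱ (t - 1)] (A t) := fun t h1 h2 =>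
    (hBmeas t h1 h2).measurableSet_le stronglyMeasurable_const
  set Z : ℕ → Ω → ℝ := fun t => (A t).indicator (fun ω => l * X t ω) with hZdef
  have hZsqeq : ∀ t, (fun ω => Z t ω ^ 2) = (A t).indicator (fun ω => l ^ 2 * X t ω ^ 2) := by
    intro t
    ext ω
    by_cases h : ω ∈ A t <;> simp [hZdef, h, mul_pow]
  have hZint : ∀ t, 1 ≤ t → t ≤ T → Integrable (Z t) P := fun t h1 h2 =>
    ((hXint t h1 h2).const_mul l).indicator (ℱ.le _ _ (hAmeas t h1 h2))
  have hZsq : ∀ t, 1 ≤ t → t ≤ T → Integrable (fun ω => Z t ω ^ 2) P := fun t h1 h2 => by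
    rw [hZsqeq]
    exact ((hXsq t h1 h2).const_mul _).indicator (ℱ.le _ _ (hAmeas t h1 h2))
  obtain ⟨-, hint, hle⟩ := integral_exp_sum_sub_condExp_sq_le_one P ℱ Z T
    (fun t h1 h2 => ((hXmeas t h1 h2).const_mul l).indicator
      (ℱ.mono (Nat.sub_le _ _) _ (hAmeas t h1 h2)))
    hZint hZsq
    (fun t h1 h2 => by
      filter_upwards [condExp_indicator ((hXint t h1 h2).const_mul l) (hAmeas t h1 h2),
        condExp_smul (μ := P) l (X t) (ℱ (t - 1)), hXcond t h1 h2] with ω h3 h4 h5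
      rw [h3]
      by_cases h : ω ∈ A t
      · rw [Set.indicator_of_mem h]
        exact h4.trans (by simp [h5])
      · rw [Set.indicator_of_notMem h]; rfl)
    (fun t h1 h2 => by
      filter_upwards [hXB t h1 h2] with ω h3
      by_cases h : ω ∈ A t
      · rw [hZdef]
        simp only [Set.indicator_of_mem h]
        exact (mul_le_mul_of_nonneg_left (h3.trans h) hl).trans hlc
      · rw [hZdef]
        simp only [Set.indicator_of_notMem h]
        exact zero_le_one)
  have hWeq : ∀ᵐ ω ∂P, ∀ t ∈ Icc 1 T, ω ∈ A t →
      (P[fun ω' => Z t ω' ^ 2|ℱ (t - 1)]) ω =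
        l ^ 2 * (P[fun ω' => X t ω' ^ 2|ℱ (t - 1)]) ω := by
    rw [Filter.eventually_all_finset]
    intro t ht
    obtain ⟨h1, h2⟩ := mem_Icc.mp ht
    filter_upwards [condExp_indicator ((hXsq t h1 h2).const_mul (l ^ 2)) (hAmeas t h1 h2),
      condExp_smul (μ := P) (l ^ 2) (fun ω => X t ω ^ 2) (ℱ (t - 1))] with ω h3 h4 h
    rw [hZsqeq, h3, Set.indicator_of_mem h]
    exact h4
  have hmarkov := mul_meas_ge_le_integral_of_nonneg
    (ae_of_all P fun ω => (Real.exp_pos (∑ t ∈ Icc 1 T,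
      (Z t ω - (P[fun ω' => Z t ω' ^ 2|ℱ (t - 1)]) ω))).le) hint (Real.exp x)
  have hreal := hmarkov.trans hle
  rw [mul_comm, ← le_div_iff₀ (Real.exp_pos x), one_div, ← Real.exp_neg] at hreal
  refine le_trans (measure_mono_ae ?_) ((ENNReal.le_ofReal_iff_toReal_le
    (measure_ne_top _ _) (Real.exp_pos _).le).mpr hreal)
  filter_upwards [hWeq] with ω hω h
  obtain ⟨hB, hV, hs⟩ := h
  refine Real.exp_le_exp.mpr ?_
  have hsum : ∑ t ∈ Icc 1 T, (Z t ω - (P[fun ω' => Z t ω' ^ 2|ℱ (t - 1)]) ω) =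
      l * ∑ t ∈ Icc 1 T, X t ω -
        l ^ 2 * ∑ t ∈ Icc 1 T, (P[fun ω' => X t ω' ^ 2|ℱ (t - 1)]) ω := by
    rw [Finset.mul_sum, Finset.mul_sum, ← Finset.sum_sub_distrib]
    refine Finset.sum_congr rfl fun t ht => ?_
    have hmem : ω ∈ A t := hB t ht
    rw [hω t ht hmem, hZdef]
    simp only [Set.indicator_of_mem hmem]
  rw [hsum]
  have := mul_le_mul_of_nonneg_left hV (sq_nonneg l)
  linarith

lemma exists_nat_lt_le_le_add_one {n : ℕ} (hn : 1 ≤ n) {y : ℝ} (h0 : 0 ≤ y) (hy : y ≤ n) :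
    ∃ k < n, (k : ℝ) ≤ y ∧ y ≤ k + 1 := by
  induction n, hn using Nat.le_induction with
  | base => exact ⟨0, one_pos, by simpa using h0, by simpa using hy⟩
  | succ n hn ih =>
    by_cases h : y ≤ n
    · obtain ⟨k, hk, h1⟩ := ih h
      exact ⟨k, hk.trans (Nat.lt_succ_self n), h1⟩
    · exact ⟨n, Nat.lt_succ_self n, (not_le.mp h).le, by exact_mod_cast hy⟩

/-- A number in `[1, eⁿ]` is, up to a factor `e`, one of `e, e², …, eⁿ`. -/
lemma exists_le_exp_le {n : ℕ} (hn : 1 ≤ n) {u : ℝ} (h1 : 1 ≤ u) (hu : Real.log u ≤ n) :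
    ∃ k ∈ range n, u ≤ Real.exp (k + 1) ∧ Real.exp (k + 1) ≤ Real.exp 1 * u := by
  obtain ⟨k, hk, h2, h3⟩ := exists_nat_lt_le_le_add_one hn (Real.log_nonneg h1) hu
  have hu0 : 0 < u := by linarith
  refine ⟨k, mem_range.mpr hk, (Real.log_le_iff_le_exp hu0).mp h3, ?_⟩
  rw [add_comm, Real.exp_add]
  exact mul_le_mul_of_nonneg_left ((Real.le_log_iff_exp_le hu0).mp h2) (Real.exp_pos _).le

/-- Optimizing the exponential parameter subject to `l ≤ 1 / c`. -/
lemma sq_mul_sq_add_le_min_mul {a c q s : ℝ} (ha : 0 < a) (hc : 0 < c) (hq : 0 < q)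
    (hs : 2 * q * a + q ^ 2 * c ≤ s) :
    (min c⁻¹ (q / a)) ^ 2 * a ^ 2 + q ^ 2 ≤ min c⁻¹ (q / a) * s := by
  rcases le_total c⁻¹ (q / a) with h | h
  · rw [min_eq_left h]
    have h1 : a ≤ q * c := by
      rw [le_div_iff₀ ha, inv_mul_le_iff₀ hc] at h
      linarith
    have h2 : c⁻¹ ^ 2 * a ^ 2 + q ^ 2 = c⁻¹ * (c⁻¹ * a ^ 2 + q ^ 2 * c) := by field_simp
    rw [h2]
    refine mul_le_mul_of_nonneg_left (le_trans ?_ hs) (inv_pos.mpr hc).le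
    have h3 : c⁻¹ * a ^ 2 ≤ q * a := by
      rw [inv_mul_le_iff₀ hc]
      nlinarith
    nlinarith [mul_pos hq ha]
  · rw [min_eq_right h]
    have h2 : (q / a) ^ 2 * a ^ 2 + q ^ 2 = q / a * (2 * q * a) := by field_simp; ring
    rw [h2]
    refine mul_le_mul_of_nonneg_left (le_trans ?_ hs) (div_pos hq ha).le
    nlinarith [mul_pos (mul_pos hq hq) hc]

/-- A violation of the final bound is a violation of the fixed-parameter bound at one of the
`n * m` scales. -/
lemma exists_scale_of_freedman_lt {n m T : ℕ} {b S L V R s : ℝ} (hT : 1 ≤ T) (hn : 1 ≤ n)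
    (hm : 1 ≤ m) (hb : 1 ≤ b) (hbn : Real.log b ≤ n) (hbm : Real.log (b ^ 2 * T) ≤ m)
    (hS : 2 ≤ S) (hL : 1 / 2 ≤ L) (hV : 1 ≤ V) (hR1 : 1 ≤ R) (hRb : R ≤ b) (hsb : s ≤ T * b)
    (hs : S * (Real.sqrt (8 * V * L) + 2 * R * L) < s) :
    ∃ j ∈ range n, ∃ i ∈ range m, R ≤ Real.exp (j + 1) ∧ V ≤ Real.exp (i + 1) ^ 2 ∧
      (min (Real.exp (j + 1))⁻¹ (Real.sqrt L / Real.exp (i + 1))) ^ 2 * Real.exp (i + 1) ^ 2 + L ≤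
        min (Real.exp (j + 1))⁻¹ (Real.sqrt L / Real.exp (i + 1)) * s := by
  have hT' : (1 : ℝ) ≤ T := by exact_mod_cast hT
  have hV0 : 0 ≤ V := by linarith
  have hL0 : 0 < L := by linarith
  set u := Real.sqrt V with hu
  set q := Real.sqrt L with hq
  have hu2 : u ^ 2 = V := Real.sq_sqrt hV0
  have hq2 : q ^ 2 = L := Real.sq_sqrt hL0.le
  have hq0 : 0 < q := Real.sqrt_pos.mpr hL0
  have hu1 : 1 ≤ u := by rw [hu]; exact Real.one_le_sqrt.mpr hV
  have hsqrt : Real.sqrt (8 * V * L) = Real.sqrt 8 * u * q := by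
    rw [Real.sqrt_mul (by positivity), Real.sqrt_mul (by norm_num)]
  have he := Real.exp_one_lt_d9
  have h8 : Real.exp 1 ≤ Real.sqrt 8 := by
    refine Real.le_sqrt_of_sq_le ?_
    nlinarith [Real.exp_pos 1]
  rw [hsqrt] at hs
  have hkey : Real.exp 1 * (2 * q * u + q ^ 2 * R) < s := by
    have h1 : 0 < u * q := by positivity
    have h2 : 0 < R * L := by positivity
    calc Real.exp 1 * (2 * q * u + q ^ 2 * R)
        = 2 * (Real.exp 1 * u * q + Real.exp 1 / 2 * R * L) := by rw [hq2]; ring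
      _ ≤ 2 * (Real.sqrt 8 * u * q + 2 * R * L) := by
          nlinarith [mul_le_mul_of_nonneg_right h8 h1.le]
      _ ≤ S * (Real.sqrt 8 * u * q + 2 * R * L) := by gcongr
      _ < s := hs
  have huT : u ≤ b ^ 2 * T := by
    have h1 : u ≤ s := by
      have h2 : 1 / 2 ≤ q := by
        rw [hq]; exact Real.le_sqrt_of_sq_le (by linarith)
      have h3 : 1 ≤ Real.exp 1 := Real.one_le_exp zero_le_one
      have h4 : 0 ≤ 2 * q * u + q ^ 2 * R := by positivity
      have h5 : 0 ≤ q ^ 2 * R := by positivity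
      nlinarith
    nlinarith [mul_nonneg (sub_nonneg.mpr hb) (by linarith : (0 : ℝ) ≤ b * T)]
  obtain ⟨j, hj, hj1, hj2⟩ := exists_le_exp_le hn hR1
    ((Real.log_le_log (by linarith) hRb).trans hbn)
  obtain ⟨i, hi, hi1, hi2⟩ := exists_le_exp_le hm hu1
    ((Real.log_le_log (by linarith) huT).trans hbm)
  refine ⟨j, hj, i, hi, hj1, ?_, ?_⟩
  · rw [← hu2]
    gcongr
  · have := sq_mul_sq_add_le_min_mul (s := s) (Real.exp_pos (i + 1)) (Real.exp_pos (j + 1)) hq0 (by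
      refine le_trans ?_ hkey.le
      calc 2 * q * Real.exp (i + 1) + q ^ 2 * Real.exp (j + 1)
          ≤ 2 * q * (Real.exp 1 * u) + q ^ 2 * (Real.exp 1 * R) := by gcongr
        _ = _ := by ring)
    rwa [hq2] at this

/-- **Strengthened Freedman inequality (Lemma 8; Theorem 2.2 of Lee et al. 2020).**
Let `X_1, …, X_T` be a martingale difference sequence w.r.t. a filtration `ℱ`,
with predictable bounds `B_t ∈ [1, b]` (`b ≥ e`) such that `X_t ≤ B_t` a.s.
Set `V := max 1 (Σ_t E[X_t² | ℱ_{t−1}])`, `B* := max_t B_t`, and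
`S := ⌈ln b⌉⌈ln(b²T)⌉`.  Then with probability at least `1 − γ`,
`Σ_t X_t ≤ S(√(8V ln(S/γ)) + 2B* ln(S/γ))`. -/
theorem freedman_strengthened {Ω : Type} {m0 : MeasurableSpace Ω}
    (P : Measure Ω) [IsProbabilityMeasure P]
    (T : ℕ) (hT : 1 ≤ T) (ℱ : Filtration ℕ m0)
    (b : ℝ) (hb : Real.exp 1 ≤ b) (γ : ℝ) (hγ : γ ∈ Set.Ioo (0 : ℝ) 1)
    (X B : ℕ → Ω → ℝ)
    (hXmeas : ∀ t, 1 ≤ t → t ≤ T → StronglyMeasurable[ℱ t] (X t))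
    (hXint : ∀ t, 1 ≤ t → t ≤ T → Integrable (X t) P)
    (hXsq : ∀ t, 1 ≤ t → t ≤ T → Integrable (fun ω => X t ω ^ 2) P)
    (hXcond : ∀ t, 1 ≤ t → t ≤ T → P[X t|ℱ (t - 1)] =ᵐ[P] 0)
    (hBmeas : ∀ t, 1 ≤ t → t ≤ T → StronglyMeasurable[ℱ (t - 1)] (B t))
    (hBrange : ∀ t, 1 ≤ t → t ≤ T → ∀ ω, B t ω ∈ Set.Icc (1 : ℝ) b)
    (hXB : ∀ t, 1 ≤ t → t ≤ T → ∀ᵐ ω ∂P, X t ω ≤ B t ω) :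
    ENNReal.ofReal (1 - γ) ≤
      P {ω | ∑ t ∈ Icc 1 T, X t ω ≤
        SconstB b T *
          (Real.sqrt (8 * max 1 (∑ t ∈ Icc 1 T, (P[fun ω' => X t ω' ^ 2|ℱ (t - 1)]) ω) *
              Real.log (SconstB b T / γ)) +
            2 * ((Icc 1 T).sup' (Finset.nonempty_Icc.mpr hT) fun t => B t ω) *
              Real.log (SconstB b T / γ))} := by
  obtain ⟨hγ0, hγ1⟩ := hγ
  have hT' : (1 : ℝ) ≤ T := by exact_mod_cast hT
  have hb1 : 1 ≤ b := (Real.one_le_exp zero_le_one).trans hb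
  have hlogb : 1 ≤ Real.log b := (Real.le_log_iff_exp_le (by linarith)).mpr hb
  have hlogT : 2 ≤ Real.log (b ^ 2 * T) := by
    rw [Real.log_mul (by positivity) (by positivity), Real.log_pow]
    have := Real.log_nonneg hT'
    push_cast
    linarith
  obtain ⟨n, hn⟩ := Int.eq_ofNat_of_zero_le (Int.ceil_nonneg (by linarith : 0 ≤ Real.log b))
  obtain ⟨m, hm⟩ := Int.eq_ofNat_of_zero_le
    (Int.ceil_nonneg (by linarith : 0 ≤ Real.log (b ^ 2 * T)))
  have hbn : Real.log b ≤ n := by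
    have := Int.le_ceil (Real.log b)
    rwa [hn] at this
  have hbm : Real.log (b ^ 2 * T) ≤ m := by
    have := Int.le_ceil (Real.log (b ^ 2 * T))
    rwa [hm] at this
  have hn1 : (1 : ℝ) ≤ n := hlogb.trans hbn
  have hm2 : (2 : ℝ) ≤ m := hlogT.trans hbm
  have hSeq : SconstB b T = n * m := by
    rw [SconstB, hn, hm]
    push_cast
    rfl
  have hS : 2 ≤ SconstB b T := by rw [hSeq]; nlinarith
  set S := SconstB b T with hSdef
  set L := Real.log (S / γ) with hLdef
  have hL : 1 / 2 ≤ L := by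
    have h1 : Real.log 2 ≤ L :=
      Real.log_le_log two_pos ((le_div_iff₀ hγ0).mpr (by nlinarith))
    linarith [Real.log_two_gt_d9]
  have hexpL : Real.exp (-L) = γ / S := by
    rw [Real.exp_neg, hLdef, Real.exp_log (by positivity), inv_div]
  set G : Set Ω := {ω | ∑ t ∈ Icc 1 T, X t ω ≤ S *
    (Real.sqrt (8 * max 1 (∑ t ∈ Icc 1 T, (P[fun ω' => X t ω' ^ 2|ℱ (t - 1)]) ω) * L) +
      2 * ((Icc 1 T).sup' (Finset.nonempty_Icc.mpr hT) fun t => B t ω) * L)} with hG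
  set l : ℕ → ℕ → ℝ := fun j i => min (Real.exp (j + 1))⁻¹ (Real.sqrt L / Real.exp (i + 1)) with hl
  set D : ℕ × ℕ → Set Ω := fun p => {ω | (∀ t ∈ Icc 1 T, B t ω ≤ Real.exp (p.1 + 1)) ∧
      ∑ t ∈ Icc 1 T, (P[fun ω' => X t ω' ^ 2|ℱ (t - 1)]) ω ≤ Real.exp (p.2 + 1) ^ 2 ∧
      l p.1 p.2 ^ 2 * Real.exp (p.2 + 1) ^ 2 + L ≤ l p.1 p.2 * ∑ t ∈ Icc 1 T, X t ω} with hD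
  have hDle : ∀ p, P (D p) ≤ ENNReal.ofReal (γ / S) := fun p => by
    rw [← hexpL]
    refine measure_freedman_le P T ℱ X B hXmeas hXint hXsq hXcond hBmeas hXB _ _ _ _
      (le_min (inv_pos.mpr (Real.exp_pos _)).le (by positivity)) ?_
    exact (mul_le_mul_of_nonneg_right (min_le_left _ _) (Real.exp_pos _).le).trans_eq
      (inv_mul_cancel₀ (Real.exp_pos _).ne')
  have hXB' : ∀ᵐ ω ∂P, ∀ t ∈ Icc 1 T, X t ω ≤ B t ω := by
    rw [Filter.eventually_all_finset]
    exact fun t ht => hXB t (mem_Icc.mp ht).1 (mem_Icc.mp ht).2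
  have hsub : Gᶜ ≤ᵐ[P] ⋃ p ∈ range n ×ˢ range m, D p := by
    filter_upwards [hXB'] with ω hω hωG
    have h1mem : 1 ∈ Icc 1 T := mem_Icc.mpr ⟨le_rfl, hT⟩
    have hBω : ∀ t ∈ Icc 1 T, B t ω ∈ Set.Icc 1 b := fun t ht =>
      hBrange t (mem_Icc.mp ht).1 (mem_Icc.mp ht).2 ω
    obtain ⟨j, hj, i, hi, h1, h2, h3⟩ := exists_scale_of_freedman_lt hT
      (by exact_mod_cast hn1) (by exact_mod_cast one_le_two.trans hm2) hb1 hbn hbm hS hL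
      (le_max_left _ _)
      ((hBω 1 h1mem).1.trans (Finset.le_sup' (fun t => B t ω) h1mem))
      (Finset.sup'_le _ _ fun t ht => (hBω t ht).2)
      (by
        have := Finset.sum_le_card_nsmul (Icc 1 T) (fun t => X t ω) b
          fun t ht => (hω t ht).trans (hBω t ht).2
        simpa using this)
      (not_le.mp hωG)
    exact Set.mem_biUnion (x := (j, i)) (mem_product.mpr ⟨hj, hi⟩)
      ⟨fun t ht => (Finset.le_sup' (fun t => B t ω) ht).trans h1, (le_max_right _ _).trans h2, h3⟩
  have hbad : P Gᶜ ≤ ENNReal.ofReal γ := by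
    calc P Gᶜ ≤ P (⋃ p ∈ range n ×ˢ range m, D p) := measure_mono_ae hsub
      _ ≤ ∑ p ∈ range n ×ˢ range m, P (D p) := measure_biUnion_finset_le _ _
      _ ≤ ∑ p ∈ range n ×ˢ range m, ENNReal.ofReal (γ / S) :=
          Finset.sum_le_sum fun p _ => hDle p
      _ = ENNReal.ofReal γ := by
          rw [← ENNReal.ofReal_sum_of_nonneg fun _ _ => by positivity]
          congr 1
          rw [Finset.sum_const, card_product, card_range, card_range, nsmul_eq_mul, Nat.cast_mul,
            ← hSeq, mul_div_cancel₀ _ (by positivity)]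
  have huniv : 1 ≤ P G + P Gᶜ := by
    rw [← measure_univ (μ := P), ← Set.union_compl_self G]
    exact measure_union_le _ _
  rw [ENNReal.ofReal_sub _ hγ0.le, ENNReal.ofReal_one, tsub_le_iff_right]
  exact huniv.trans (add_le_add le_rfl hbad)
end
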